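/- Let R be a ring, let 0 → A →ⁱ E →ᵖ B → 0 be a short exact sequence of R-modules, and let M be an R-module. Then the six-term sequence of abelian groups 0 → Hom_R(B, M) → Hom_R(E, M) → Hom_R(A, M) → Ext¹_R(B, M) → Ext¹_R(E, M) → Ext¹_R(A, M) is exact, where the maps between Hom groups and between Ext groups are induced by p and i via contravariant functoriality, and the connecting map Hom_R(A, M) → Ext¹_R(B, M) sends f to the class of the pushout of the given extension along f. -/

import Mathlib

open CategoryTheory

universe w u

/-- for a short exact sequence `0 → A →ⁱ E →ᵖ B → 0` of `R`-modules and an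
`R`-module `M`, the six-term sequence
`0 → Hom(B,M) → Hom(E,M) → Hom(A,M) → Ext¹(B,M) → Ext¹(E,M) → Ext¹(A,M)`
is exact, where the maps are induced by `p` and `i` by contravariant functoriality and the
connecting map sends `f : A ⟶ M` to the pushout of the extension along `f`, i.e. to the
composition of the extension class of the sequence with `f`. -/
theorem stmt8 {R : Type u} [Ring R] [HasExt.{w} (ModuleCat.{u} R)]
    (S : ShortComplex (ModuleCat.{u} R)) (hS : S.ShortExact) (M : ModuleCat.{u} R) :
    -- exactness at `Hom(B, M)`: the map `p^*` is injective
    (∀ f g : S.X₃ ⟶ M, S.g ≫ f = S.g ≫ g → f = g) ∧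
    -- exactness at `Hom(E, M)`
    (∀ f : S.X₂ ⟶ M, S.f ≫ f = 0 ↔ ∃ g : S.X₃ ⟶ M, S.g ≫ g = f) ∧
    -- exactness at `Hom(A, M)`
    (∀ f : S.X₁ ⟶ M,
      hS.extClass.comp (Abelian.Ext.mk₀ f) (add_zero 1) = 0 ↔ ∃ g : S.X₂ ⟶ M, S.f ≫ g = f) ∧
    -- exactness at `Ext¹(B, M)`
    (∀ x : Abelian.Ext S.X₃ M 1,
      (Abelian.Ext.mk₀ S.g).comp x (zero_add 1) = 0 ↔
        ∃ f : S.X₁ ⟶ M, hS.extClass.comp (Abelian.Ext.mk₀ f) (add_zero 1) = x) ∧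
    -- exactness at `Ext¹(E, M)`
    (∀ x : Abelian.Ext S.X₂ M 1,
      (Abelian.Ext.mk₀ S.f).comp x (zero_add 1) = 0 ↔
        ∃ y : Abelian.Ext S.X₃ M 1, (Abelian.Ext.mk₀ S.g).comp y (zero_add 1) = x) := by
  have : Mono S.f := hS.mono_f
  have : Epi S.g := hS.epi_g
  refine ⟨fun f g h => (cancel_epi S.g).1 h, fun f => ⟨fun h => ?_, ?_⟩,
    fun f => ⟨fun h => ?_, ?_⟩, fun x => ⟨fun h => ?_, ?_⟩, fun x => ⟨fun h => ?_, ?_⟩⟩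
  · exact ⟨hS.exact.desc f h, hS.exact.g_desc f h⟩
  · rintro ⟨g, rfl⟩
    rw [S.zero_assoc, Limits.zero_comp]
  · obtain ⟨y, hy⟩ := Abelian.Ext.contravariant_sequence_exact₁ hS M _ (add_zero 1) h
    obtain ⟨g, rfl⟩ := Abelian.Ext.addEquiv₀.symm.surjective y
    refine ⟨g, Abelian.Ext.addEquiv₀.symm.injective ?_⟩
    simpa using hy
  · rintro ⟨g, rfl⟩
    rw [← Abelian.Ext.mk₀_comp_mk₀, hS.extClass_comp_assoc]
  · obtain ⟨y, hy⟩ := Abelian.Ext.contravariant_sequence_exact₃ hS M x h (add_zero 1)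
    obtain ⟨f, rfl⟩ := Abelian.Ext.addEquiv₀.symm.surjective y
    exact ⟨f, hy⟩
  · rintro ⟨f, rfl⟩
    exact hS.comp_extClass_assoc _ _
  · exact Abelian.Ext.contravariant_sequence_exact₂ hS M x h
  · rintro ⟨y, rfl⟩
    simp
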